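/- arXiv:1904.09070 — 2 statements merged into one kernel-verified Lean document; each statement's English description precedes it below -/
import Mathlib

section
/- ∫₀^∞ sin(π x²)/cosh(π x) dx = (−1 + √2)/(2√2). -/
open Real MeasureTheory

lemma cosh_lb (x : ℝ) : (1 + x ^ 2) / 2 ≤ Real.cosh (π * x) := by
  rw [← Real.cosh_abs, Real.cosh_eq]
  have h := Real.quadratic_le_exp_of_nonneg (abs_nonneg (π * x))
  have h2 := Real.exp_pos (-|π * x|)
  have h3 := abs_nonneg (π * x)
  rw [sq_abs] at h
  have h4 : 9 * x ^ 2 ≤ (π * x) ^ 2 := by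
    rw [mul_pow]
    have := Real.pi_gt_three
    gcongr
    nlinarith
  nlinarith [sq_nonneg x]

lemma sech_int : Integrable (fun x : ℝ => 1 / Real.cosh (π * x)) := by
  refine Integrable.mono' (g := fun x => 2 * (1 + x ^ 2)⁻¹) (integrable_inv_one_add_sq.const_mul 2)
    ?_ (Filter.Eventually.of_forall fun x => ?_)
  · apply Continuous.aestronglyMeasurable
    exact continuous_const.div (by fun_prop) fun x => (Real.cosh_pos _).ne'
  · have h := cosh_lb x
    have h0 : 0 < 1 + x ^ 2 := by positivity
    have := Real.cosh_pos (π * x)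
    rw [Real.norm_of_nonneg (by positivity), ← div_eq_mul_inv, div_le_div_iff₀ this h0]
    linarith

lemma sech_integral : ∫ x : ℝ, 1 / Real.cosh (π * x) = 1 := by
  have hd : ∀ x : ℝ, HasDerivAt (fun x => 2 / π * Real.arctan (Real.exp (π * x)))
      (1 / Real.cosh (π * x)) x := by
    intro x
    have h1 : HasDerivAt (fun x : ℝ => π * x) π x := by
      simpa using (hasDerivAt_id x).const_mul π
    have h := (h1.exp.arctan).const_mul (2 / π)
    refine h.congr_deriv ?_
    rw [Real.cosh_eq, Real.exp_neg]
    have := Real.exp_pos (π * x)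
    field_simp
    ring
  have hp := Real.pi_pos
  have hbot : Filter.Tendsto (fun x => 2 / π * Real.arctan (Real.exp (π * x))) Filter.atBot
      (nhds (2 / π * Real.arctan 0)) := by
    apply Filter.Tendsto.const_mul
    apply (Real.continuous_arctan.tendsto 0).comp
    apply Real.tendsto_exp_atBot.comp
    exact Filter.tendsto_id.const_mul_atBot hp
  have htop : Filter.Tendsto (fun x => 2 / π * Real.arctan (Real.exp (π * x))) Filter.atTop
      (nhds (2 / π * (π / 2))) := by
    apply Filter.Tendsto.const_mul
    apply (tendsto_nhds_of_tendsto_nhdsWithin Real.tendsto_arctan_atTop).comp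
    apply Real.tendsto_exp_atTop.comp
    exact Filter.tendsto_id.const_mul_atTop hp
  rw [integral_of_hasDerivAt_of_tendsto hd sech_int hbot htop]
  simp

lemma norm_cosh_lb (x y : ℝ) : |Real.sinh x| ≤ ‖Complex.cosh (x + y * Complex.I)‖ := by
  have h : Complex.cosh (x + y * Complex.I) =
      ((Real.cosh x * Real.cos y : ℝ) : ℂ) + ((Real.sinh x * Real.sin y : ℝ) : ℂ) * Complex.I := by
    rw [Complex.cosh_add, Complex.cosh_mul_I, Complex.sinh_mul_I]
    push_cast; ring
  rw [h, Complex.norm_add_mul_I]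
  apply Real.le_sqrt_of_sq_le
  rw [sq_abs]
  have h1 := Real.cosh_sq x
  have h2 := Real.sin_sq_add_cos_sq y
  have h3 : Real.sin y ^ 2 = 1 - Real.cos y ^ 2 := by linarith
  rw [mul_pow, mul_pow, h1, h3]
  nlinarith [sq_nonneg (Real.cos y)]

lemma cosh_zero {z : ℂ} (h0 : 0 ≤ z.im) (h1 : z.im ≤ 1) (h : Complex.cosh (π * z) = 0) :
    z = Complex.I / 2 := by
  rw [← Complex.cos_mul_I, Complex.cos_eq_zero_iff] at h
  obtain ⟨k, hk⟩ := h
  have hp : (π : ℂ) ≠ 0 := by exact_mod_cast Real.pi_ne_zero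
  have hz : z = -((2 * k + 1) / 2) * Complex.I := by
    have : z * Complex.I = (2 * k + 1) / 2 := by
      apply mul_left_cancel₀ hp; linear_combination hk
    linear_combination (-Complex.I) * this + z * Complex.I_mul_I
  have him : z.im = -((2 * (k:ℝ) + 1) / 2) := by
    have : z = ((-((2 * (k:ℝ) + 1) / 2) : ℝ) : ℂ) * Complex.I := by rw [hz]; push_cast; ring
    rw [this, Complex.im_ofReal_mul, Complex.I_im, mul_one]
  have a : (k:ℝ) < 0 := by linarith
  have b : (-2:ℝ) < k := by linarith
  have a' : k < 0 := by exact_mod_cast a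
  have b' : -2 < k := by exact_mod_cast b
  have : k = -1 := by omega
  rw [hz, this]; push_cast; ring

lemma cosh_pi_I (z : ℂ) : Complex.cosh (π * (z + Complex.I)) = - Complex.cosh (π * z) := by
  rw [mul_add, Complex.cosh_add, Complex.cosh_mul_I, Complex.sinh_mul_I]
  simp

lemma contour (b : ℂ) :
    ∃ F : ℂ → ℂ, (∀ z ≠ Complex.I / 2, F z =
        (Complex.exp (b * z ^ 2) - Complex.exp (-b / 4)) / Complex.cosh (π * z)) ∧
      DifferentiableOn ℂ F {z | 0 ≤ z.im ∧ z.im ≤ 1} := by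
  set c := Complex.I / 2 with hc
  let N : ℂ → ℂ := fun z => Complex.exp (b * z ^ 2) - Complex.exp (-b / 4)
  let C : ℂ → ℂ := fun z => Complex.cosh (π * z)
  have hp : (π : ℂ) ≠ 0 := by exact_mod_cast Real.pi_ne_zero
  have hN : N c = 0 := by
    simp only [N, hc, div_pow, Complex.I_sq]; ring_nf
  have hCd : HasDerivAt C (Complex.sinh (π * c) * π) c := by
    have h1 : HasDerivAt (fun x : ℂ => π * x) π c := by
      simpa using (hasDerivAt_id c).const_mul (π:ℂ)
    exact h1.ccosh
  have hpc : (π : ℂ) * c = (π / 2 : ℝ) * Complex.I := by rw [hc]; push_cast; ring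
  have hC : C c = 0 := by
    simp only [C]; rw [hpc, Complex.cosh_mul_I, ← Complex.ofReal_cos]; simp
  have hC' : deriv C c ≠ 0 := by
    rw [hCd.deriv, hpc, Complex.sinh_mul_I, ← Complex.ofReal_sin]; simp [hp]
  have dN : Differentiable ℂ (dslope N c) := by
    rw [← differentiableOn_univ, Complex.differentiableOn_dslope Filter.univ_mem]
    exact (by fun_prop : Differentiable ℂ N).differentiableOn
  have dC : Differentiable ℂ (dslope C c) := by
    rw [← differentiableOn_univ, Complex.differentiableOn_dslope Filter.univ_mem]
    exact (by fun_prop : Differentiable ℂ C).differentiableOn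
  refine ⟨fun z => dslope N c z / dslope C c z, ?_, ?_⟩
  · intro z hz
    have : z - c ≠ 0 := sub_ne_zero.2 hz
    simp only [dslope_of_ne _ hz, slope_def_field, hN, hC, sub_zero]
    rw [div_div_div_cancel_right₀ this]
  · intro z hz
    refine (dN z).differentiableWithinAt.div (dC z).differentiableWithinAt ?_
    by_cases h : z = c
    · rw [h, dslope_same]; exact hC'
    · rw [dslope_of_ne _ h, slope_def_field, hC, sub_zero]
      exact div_ne_zero (fun h0 => h (cosh_zero hz.1 hz.2 h0)) (sub_ne_zero.2 h)

lemma int_quad (b c : ℂ) (hb : b.re < 0) :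
    Integrable (fun x : ℝ => Complex.exp (b * x ^ 2 + c * x) / Complex.cosh (π * x)) := by
  refine Integrable.mono (integrable_cexp_quadratic' hb c 0) ?_
    (Filter.Eventually.of_forall fun x => ?_)
  · apply Continuous.aestronglyMeasurable
    refine Continuous.div (by fun_prop) (by fun_prop) fun x => ?_
    rw [← Complex.ofReal_mul, ← Complex.ofReal_cosh]
    exact_mod_cast (Real.cosh_pos _).ne'
  · rw [add_zero, norm_div]
    apply div_le_self (norm_nonneg _)
    rw [← Complex.ofReal_mul, ← Complex.ofReal_cosh, Complex.norm_real, Real.norm_eq_abs]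
    exact (Real.one_le_cosh _).trans (le_abs_self _)

lemma csech_int : Integrable (fun x : ℝ => 1 / Complex.cosh (π * x)) := by
  have := sech_int.ofReal (𝕜 := ℂ)
  refine this.congr (Filter.Eventually.of_forall fun x => ?_)
  simp

lemma csech_integral : ∫ x : ℝ, 1 / Complex.cosh (π * x) = 1 := by
  have := congrArg (fun x : ℝ => (x : ℂ)) sech_integral
  simp only [← integral_complex_ofReal] at this
  refine Eq.trans ?_ (this.trans Complex.ofReal_one)
  congr 1; ext x; simp

lemma vert_bound (b : ℂ) (hb : b.re < 0) : ∃ K : ℝ, ∀ R y : ℝ, 0 < |R| → 0 ≤ y → y ≤ 1 →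
    ‖(Complex.exp (b * (R + y * Complex.I) ^ 2) - Complex.exp (-b / 4)) /
      Complex.cosh (π * (R + y * Complex.I))‖ ≤ K / |R| := by
  refine ⟨Real.exp (-b.re + b.im ^ 2 / (-b.re)) + ‖Complex.exp (-b / 4)‖, fun R y hR hy hy1 => ?_⟩
  rw [norm_div]
  have hre : (b * (R + y * Complex.I) ^ 2).re = b.re * (R ^ 2 - y ^ 2) - b.im * (2 * R * y) := by
    simp only [pow_two, Complex.mul_re, Complex.mul_im, Complex.add_re, Complex.add_im,
      Complex.ofReal_re, Complex.ofReal_im, Complex.I_re, Complex.I_im]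
    ring
  apply div_le_div₀
  · positivity
  · refine (norm_sub_le _ _).trans ?_
    gcongr
    rw [Complex.norm_exp, hre]
    apply Real.exp_le_exp.2
    have h1 : 0 ≤ (-b.re) * (1 - y ^ 2) := mul_nonneg (by linarith) (by nlinarith)
    have hq : 0 ≤ b.im ^ 2 / (-b.re) * (1 - y ^ 2) := by
      apply mul_nonneg
      · apply div_nonneg (sq_nonneg _); linarith
      · nlinarith
    have h2 : 0 ≤ (-b.re) * (R + b.im * y / (-b.re)) ^ 2 := by
      apply mul_nonneg (by linarith) (sq_nonneg _)
    have h3 : (-b.re) * (R + b.im * y / (-b.re)) ^ 2 =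
      (-b.re) * R ^ 2 + 2 * R * b.im * y + b.im ^ 2 / (-b.re) * y ^ 2 := by
      have : b.re ≠ 0 := hb.ne
      field_simp; ring
    nlinarith
  · exact hR
  · have h := norm_cosh_lb (π * R) (π * y)
    have e : ((π * R : ℝ) : ℂ) + ((π * y : ℝ) : ℂ) * Complex.I = π * (R + y * Complex.I) := by
      push_cast; ring
    rw [e] at h
    refine le_trans ?_ h
    have h2 : |Real.sinh (π * R)| = Real.sinh (π * |R|) := by
      rw [Real.abs_sinh, abs_mul, abs_of_pos Real.pi_pos]
    rw [h2]
    refine le_trans ?_ (Real.self_le_sinh_iff.2 (by positivity))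
    nlinarith [Real.pi_gt_three]

lemma key (b : ℂ) (hb : b.re < 0) :
    (∫ x : ℝ, Complex.exp (b * x ^ 2) / Complex.cosh (π * x)) + Complex.exp (-b) *
      (∫ x : ℝ, Complex.exp (b * x ^ 2 + 2 * Complex.I * b * x) / Complex.cosh (π * x))
      = 2 * Complex.exp (-b / 4) := by
  obtain ⟨F, hF, hFd⟩ := contour b
  obtain ⟨K, hK⟩ := vert_bound b hb
  set A := Complex.exp (-b / 4) with hA
  have ne1 : ∀ x : ℝ, (x : ℂ) ≠ Complex.I / 2 := fun x h => by
    simpa using congrArg Complex.im h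
  have ne2 : ∀ x : ℝ, (x : ℂ) + Complex.I ≠ Complex.I / 2 := fun x h => by
    have := congrArg Complex.im h
    norm_num at this
  have ne3 : ∀ R y : ℝ, 0 < |R| → (R : ℂ) + y * Complex.I ≠ Complex.I / 2 := fun R y hR h => by
    have := congrArg Complex.re h
    simp at this
    simp [this] at hR
  have i0 := int_quad b 0 hb
  have i1 := int_quad b (2 * Complex.I * b) hb
  simp only [zero_mul, add_zero] at i0
  have f0 : ∀ x : ℝ, F (x + (0:ℝ) * Complex.I) =
      Complex.exp (b * x ^ 2) / Complex.cosh (π * x) - A * (1 / Complex.cosh (π * x)) := by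
    intro x
    rw [Complex.ofReal_zero, zero_mul, add_zero, hF _ (ne1 x)]; ring
  have f1 : ∀ x : ℝ, F (x + (1:ℝ) * Complex.I) =
      -(Complex.exp (-b) * (Complex.exp (b * x ^ 2 + 2 * Complex.I * b * x) / Complex.cosh (π * x)))
       + A * (1 / Complex.cosh (π * x)) := by
    intro x
    rw [Complex.ofReal_one, one_mul, hF _ (ne2 x), cosh_pi_I]
    have : b * (x + Complex.I) ^ 2 = -b + (b * x ^ 2 + 2 * Complex.I * b * x) := by
      linear_combination b * Complex.I_sq
    rw [this, Complex.exp_add (-b), div_neg]; ring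
  have j0 : Integrable (fun x : ℝ => F (x + (0:ℝ) * Complex.I)) := by
    simp only [f0]; exact i0.sub (csech_int.const_mul A)
  have j1 : Integrable (fun x : ℝ => F (x + (1:ℝ) * Complex.I)) := by
    simp only [f1]; exact (i1.const_mul _).neg.add (csech_int.const_mul A)
  have t0 := intervalIntegral_tendsto_integral j0 Filter.tendsto_neg_atTop_atBot Filter.tendsto_id
  have t1 := intervalIntegral_tendsto_integral j1 Filter.tendsto_neg_atTop_atBot Filter.tendsto_id
  have rect : ∀ R : ℝ, (∫ x : ℝ in (-R)..R, F (x + (0:ℝ) * Complex.I)) -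
      (∫ x : ℝ in (-R)..R, F (x + (1:ℝ) * Complex.I)) +
      Complex.I • (∫ y : ℝ in (0:ℝ)..1, F ((R:ℝ) + y * Complex.I)) -
      Complex.I • (∫ y : ℝ in (0:ℝ)..1, F ((-R:ℝ) + y * Complex.I)) = 0 := by
    intro R
    have := Complex.integral_boundary_rect_eq_zero_of_differentiableOn F (-R : ℝ) (R + Complex.I)
      (hFd.mono ?_)
    · simpa using this
    · intro z hz
      have := hz.2
      simpa using this
  have v : ∀ R : ℝ, 0 < |R| → ‖∫ y : ℝ in (0:ℝ)..1, F ((R:ℝ) + y * Complex.I)‖ ≤ K / |R| := by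
    intro R hR
    have := intervalIntegral.norm_integral_le_of_norm_le_const (a := 0) (b := 1) (C := K / |R|)
      (f := fun y : ℝ => F ((R:ℝ) + y * Complex.I)) ?_
    · simpa using this
    · intro y hy
      rw [Set.uIoc_of_le zero_le_one] at hy
      rw [hF _ (ne3 R y hR)]
      exact hK R y hR hy.1.le hy.2
  have tK : Filter.Tendsto (fun R : ℝ => K / |R|) Filter.atTop (nhds 0) :=
    Filter.tendsto_abs_atTop_atTop.const_div_atTop K
  have v1 : Filter.Tendsto (fun R : ℝ => ∫ y : ℝ in (0:ℝ)..1, F ((R:ℝ) + y * Complex.I))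
      Filter.atTop (nhds 0) := by
    apply squeeze_zero_norm' _ tK
    filter_upwards [Filter.eventually_gt_atTop 0] with R hR using v R (abs_pos.2 hR.ne')
  have v2 : Filter.Tendsto (fun R : ℝ => ∫ y : ℝ in (0:ℝ)..1, F ((-R:ℝ) + y * Complex.I))
      Filter.atTop (nhds 0) := by
    apply squeeze_zero_norm' _ tK
    filter_upwards [Filter.eventually_gt_atTop 0] with R hR
    have := v (-R) (by rw [abs_neg]; exact abs_pos.2 hR.ne')
    rwa [abs_neg] at this
  have lim := ((t0.sub t1).add (v1.const_smul Complex.I)).sub (v2.const_smul Complex.I)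
  have lim2 := lim.congr rect
  have fin := tendsto_nhds_unique lim2 tendsto_const_nhds
  simp only [f0, f1, smul_zero, add_zero, sub_zero] at fin
  have i2 : Integrable (fun x : ℝ => -(Complex.exp (-b) *
      (Complex.exp (b * x ^ 2 + 2 * Complex.I * b * x) / Complex.cosh (π * x)))) :=
    (i1.const_mul _).neg
  rw [integral_sub i0 (csech_int.const_mul A), integral_add i2
    (csech_int.const_mul A), integral_neg, integral_const_mul, integral_const_mul,
    csech_integral] at fin
  linear_combination fin

lemma key2 (b c : ℂ) (hb : b.re < 0) :
    (∫ x : ℝ, Complex.exp (b * x ^ 2 + (c + π) * x) / Complex.cosh (π * x)) +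
      (∫ x : ℝ, Complex.exp (b * x ^ 2 + (c - π) * x) / Complex.cosh (π * x))
      = 2 * ((π / -b) ^ (1 / 2 : ℂ) * Complex.exp (- c ^ 2 / (4 * b))) := by
  rw [← integral_add (int_quad b _ hb) (int_quad b _ hb)]
  have := integral_cexp_quadratic hb c 0
  rw [zero_sub, ← neg_div] at this
  rw [← this, ← integral_const_mul]
  congr 1; ext x
  have hc : Complex.cosh (π * x) ≠ 0 := by
    rw [← Complex.ofReal_mul, ← Complex.ofReal_cosh]
    exact_mod_cast (Real.cosh_pos _).ne'
  rw [← add_div, div_eq_iff hc, Complex.cosh]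
  have e1 : b * (x:ℂ) ^ 2 + (c + π) * x = (b * x ^ 2 + c * x + 0) + π * x := by ring
  have e2 : b * (x:ℂ) ^ 2 + (c - π) * x = (b * x ^ 2 + c * x + 0) + -(π * x) := by ring
  rw [e1, e2]
  generalize b * (x:ℂ) ^ 2 + c * x + 0 = E
  rw [Complex.exp_add, Complex.exp_add]; ring

/-- The parameter `π i (1 + i ε)`. -/
noncomputable def bb (ε : ℝ) : ℂ := π * Complex.I - π * ε

lemma bb_re (ε : ℝ) : (bb ε).re = - (π * ε) := by simp [bb]

lemma eqn (ε : ℝ) (h : 0 < ε) :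
    (∫ x : ℝ, Complex.exp (bb ε * x ^ 2 + (0 * x)) / Complex.cosh (π * x)) -
     Complex.exp (-bb ε) *
      (∫ x : ℝ, Complex.exp (bb ε * x ^ 2 + (-2 * π * Complex.I * ε) * x) / Complex.cosh (π * x))
    = 2 * Complex.exp (-bb ε / 4) - Complex.exp (-bb ε) *
      (2 * ((π / -bb ε) ^ (1 / 2 : ℂ) *
        Complex.exp (- (-π - 2 * π * Complex.I * ε) ^ 2 / (4 * bb ε)))) := by
  have hb : (bb ε).re < 0 := by rw [bb_re]; have := Real.pi_pos; simp; positivity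
  have k1 := key _ hb
  have k2 := key2 _ (-π - 2 * π * Complex.I * ε) hb
  have e1 : (-π - 2 * π * Complex.I * ε + π : ℂ) = -2 * π * Complex.I * ε := by ring
  have e2 : (-π - 2 * π * Complex.I * ε - π : ℂ) = 2 * Complex.I * bb ε := by
    rw [bb]; linear_combination (-2 * π : ℂ) * Complex.I_sq
  rw [e1, e2] at k2
  simp only [zero_mul, add_zero]
  linear_combination k1 - Complex.exp (-bb ε) * k2

lemma lim_int (g : ℝ → ℝ) (hg : Filter.Tendsto g (nhdsWithin 0 (Set.Ioi 0)) (nhds 0)) :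
    Filter.Tendsto (fun ε : ℝ => ∫ x : ℝ, Complex.exp (bb ε * x ^ 2 + (g ε * Complex.I) * x) /
      Complex.cosh (π * x)) (nhdsWithin 0 (Set.Ioi 0))
      (nhds (∫ x : ℝ, Complex.exp (π * Complex.I * x ^ 2) / Complex.cosh (π * x))) := by
  have hc : ∀ x : ℝ, Complex.cosh (π * x) ≠ 0 := by
    intro x
    rw [← Complex.ofReal_mul, ← Complex.ofReal_cosh]
    exact_mod_cast (Real.cosh_pos _).ne'
  have hbb : Filter.Tendsto bb (nhdsWithin 0 (Set.Ioi 0)) (nhds (π * Complex.I)) := by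
    have : Continuous bb := by unfold bb; fun_prop
    have := this.tendsto 0
    simp only [bb, Complex.ofReal_zero, mul_zero, sub_zero] at this
    exact this.mono_left nhdsWithin_le_nhds
  apply tendsto_integral_filter_of_dominated_convergence (fun x => 1 / Real.cosh (π * x))
  · refine Filter.Eventually.of_forall fun ε => Continuous.aestronglyMeasurable ?_
    exact Continuous.div (by fun_prop) (by fun_prop) hc
  · filter_upwards [self_mem_nhdsWithin] with ε hε
    refine Filter.Eventually.of_forall fun x => ?_
    have hε' : 0 < ε := hε
    rw [norm_div, ← Complex.ofReal_mul, ← Complex.ofReal_cosh, Complex.norm_real,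
      Real.norm_of_nonneg (Real.cosh_pos _).le]
    have := Real.cosh_pos (π * x)
    gcongr
    rw [Complex.norm_exp, Real.exp_le_one_iff]
    have : (bb ε * x ^ 2 + (g ε * Complex.I) * x).re = -(π * ε) * x ^ 2 := by
      rw [← bb_re]; simp [pow_two]
    rw [this]
    have := Real.pi_pos
    have : 0 ≤ π * ε * x ^ 2 := by positivity
    linarith
  · exact sech_int
  · refine Filter.Eventually.of_forall fun x => ?_
    apply Filter.Tendsto.div_const
    apply (Complex.continuous_exp.tendsto _).comp
    have h2 : Filter.Tendsto (fun ε => (g ε : ℂ)) (nhdsWithin 0 (Set.Ioi 0)) (nhds 0) := by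
      simpa [Function.comp_def] using (Complex.continuous_ofReal.tendsto 0).comp hg
    have := (hbb.mul_const ((x:ℂ) ^ 2)).add ((h2.mul_const Complex.I).mul_const (x:ℂ))
    simpa using this

lemma full : ∫ x : ℝ, Complex.exp (π * Complex.I * x ^ 2) / Complex.cosh (π * x) =
    Complex.I + Complex.exp (-(π / 4 : ℝ) * Complex.I) := by
  have hp : (π : ℂ) ≠ 0 := by exact_mod_cast Real.pi_ne_zero
  have l0 := lim_int (fun _ => 0) tendsto_const_nhds
  have l1 := lim_int (fun ε => -2 * π * ε) (by
    have : Continuous (fun ε : ℝ => -2 * π * ε) := by fun_prop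
    simpa using (this.tendsto 0).mono_left nhdsWithin_le_nhds)
  have hbc : ContinuousAt bb 0 := by unfold bb; fun_prop
  have hb0 : bb 0 = π * Complex.I := by simp [bb]
  have hbne : bb 0 ≠ 0 := by rw [hb0]; exact mul_ne_zero hp Complex.I_ne_zero
  have hpb : (π : ℂ) / -bb 0 = Complex.I := by
    rw [hb0]; field_simp; simp
  have cE : ContinuousAt (fun ε => Complex.exp (-bb ε)) 0 := by fun_prop
  have tE := cE.tendsto.mono_left (nhdsWithin_le_nhds (s := Set.Ioi (0:ℝ)))
  have cR : ContinuousAt (fun ε : ℝ => 2 * Complex.exp (-bb ε / 4) - Complex.exp (-bb ε) *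
      (2 * ((π / -bb ε) ^ (1 / 2 : ℂ) *
        Complex.exp (- (-π - 2 * π * Complex.I * ε) ^ 2 / (4 * bb ε))))) 0 := by
    have c1 : ContinuousAt (fun ε : ℝ => (π : ℂ) / -bb ε) 0 :=
      continuousAt_const.div hbc.neg (neg_ne_zero.2 hbne)
    have c2 : ContinuousAt (fun ε : ℝ => ((π : ℂ) / -bb ε) ^ (1 / 2 : ℂ)) 0 := by
      apply c1.cpow continuousAt_const
      rw [hpb]; simp [Complex.slitPlane]
    have c3 : ContinuousAt (fun ε : ℝ => - (-π - 2 * π * Complex.I * (ε:ℂ)) ^ 2 / (4 * bb ε)) 0 :=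
      ContinuousAt.div (by fun_prop) (by fun_prop) (mul_ne_zero (by norm_num) hbne)
    exact (by fun_prop : ContinuousAt (fun ε => 2 * Complex.exp (-bb ε / 4)) 0).sub
      (cE.mul (continuousAt_const.mul (c2.mul c3.cexp)))
  have tR := cR.tendsto.mono_left (nhdsWithin_le_nhds (s := Set.Ioi (0:ℝ)))
  have tL := l0.sub (tE.mul l1)
  have := tendsto_nhds_unique (tL.congr' ?_) tR
  · rw [hpb, hb0] at this
    have e1 : Complex.exp (-(π * Complex.I)) = -1 := by
      rw [Complex.exp_neg, Complex.exp_pi_mul_I]; norm_num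
    have e2 : Complex.I ^ (1 / 2 : ℂ) = Complex.exp (π / 4 * Complex.I) := by
      rw [Complex.cpow_def_of_ne_zero Complex.I_ne_zero, Complex.log_I]; congr 1; ring
    have e3 : -(-π - 2 * π * Complex.I * ((0:ℝ):ℂ)) ^ 2 / (4 * (π * Complex.I)) =
        π / 4 * Complex.I := by
      have := Complex.I_ne_zero
      have h2 := Complex.I_sq
      rw [Complex.ofReal_zero, div_eq_iff (by simp [hp])]
      linear_combination (-(π:ℂ)^2) * h2
    have e4 : Complex.exp (π / 4 * Complex.I) * Complex.exp (π / 4 * Complex.I) = Complex.I := by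
      rw [← Complex.exp_add]
      refine Eq.trans ?_ Complex.exp_pi_div_two_mul_I
      congr 1; ring
    have e5 : -(π * Complex.I) / 4 = (-(π / 4 : ℝ) * Complex.I) := by push_cast; ring
    rw [e1, e2, e3, e4, e5] at this
    linear_combination this / 2
  · filter_upwards [self_mem_nhdsWithin] with ε hε
    have := eqn ε hε
    rw [← this]
    congr 1
    · simp
    · congr 2; ext x; push_cast; ring_nf

theorem stmt8 :
    ∫ x in Set.Ioi (0:ℝ), Real.sin (π * x ^ 2) / Real.cosh (π * x) = (-1 + Real.sqrt 2) / (2 * Real.sqrt 2) := by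
  have hi : Integrable (fun x : ℝ =>
      Complex.exp (π * Complex.I * x ^ 2) / Complex.cosh (π * x)) := by
    refine Integrable.mono csech_int (Continuous.aestronglyMeasurable ?_)
      (Filter.Eventually.of_forall fun x => ?_)
    · refine Continuous.div (by fun_prop) (by fun_prop) fun x => ?_
      rw [← Complex.ofReal_mul, ← Complex.ofReal_cosh]
      exact_mod_cast (Real.cosh_pos _).ne'
    · rw [norm_div, norm_div, Complex.norm_exp]
      simp [pow_two]
  have h1 := integral_im hi
  have h2 := integral_comp_abs (f := fun x => Real.sin (π * x ^ 2) / Real.cosh (π * x))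
  have h3 : ∀ x : ℝ, RCLike.im (Complex.exp (π * Complex.I * x ^ 2) / Complex.cosh (π * x)) =
      Real.sin (π * |x| ^ 2) / Real.cosh (π * |x|) := by
    intro x
    have hx : Real.cosh (π * |x|) = Real.cosh (π * x) := by
      rw [← Real.cosh_abs (π * x), abs_mul, abs_of_pos Real.pi_pos]
    rw [hx, sq_abs, ← Complex.ofReal_mul, ← Complex.ofReal_cosh]
    have : (π : ℂ) * Complex.I * x ^ 2 = ((π * x ^ 2 : ℝ) : ℂ) * Complex.I := by push_cast; ring
    rw [this]
    simp only [RCLike.im_to_complex]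
    rw [Complex.div_ofReal_im, Complex.exp_ofReal_mul_I_im]
  simp only [h3] at h1
  rw [h2, full] at h1
  have e : (-(π / 4 : ℝ) * Complex.I : ℂ) = ((-(π / 4) : ℝ) : ℂ) * Complex.I := by push_cast; ring
  rw [e] at h1
  simp only [RCLike.im_to_complex, Complex.add_im, Complex.I_im, Complex.exp_ofReal_mul_I_im,
    Real.sin_neg, Real.sin_pi_div_four] at h1
  have hs : Real.sqrt 2 ^ 2 = 2 := Real.sq_sqrt (by norm_num)
  have hs0 : 0 < Real.sqrt 2 := by positivity
  rw [eq_div_iff (by positivity)]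
  linear_combination Real.sqrt 2 * h1 - hs / 2
end

section
/- ∫₀^∞ sin(π x²)/(1 + 2·cosh(2π x/√3)) dx = (−√12 + √2 + √6)/8. -/
open Real MeasureTheory

namespace Mordell

open Filter Topology

lemma diffAt_quot (N D : ℂ → ℂ) (hN : Differentiable ℂ N) (hD : Differentiable ℂ D) (c : ℂ)
    (h : D c = 0 → N c = 0 ∧ deriv D c ≠ 0) :
    DifferentiableAt ℂ (fun z => if D z = 0 then deriv N z / deriv D z else N z / D z) c := by
  by_cases hc : D c = 0
  · obtain ⟨h1, h2⟩ := h hc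
    have dN : DifferentiableAt ℂ (dslope N c) c :=
      ((Complex.differentiableOn_dslope (s := Set.univ) univ_mem).2
        hN.differentiableOn).differentiableAt univ_mem
    have dD : DifferentiableAt ℂ (dslope D c) c :=
      ((Complex.differentiableOn_dslope (s := Set.univ) univ_mem).2
        hD.differentiableOn).differentiableAt univ_mem
    have h3 : dslope D c c ≠ 0 := by rwa [dslope_same]
    have h4 : ∀ᶠ z in 𝓝 c, dslope D c z ≠ 0 := dD.continuousAt.eventually_ne h3
    refine (dN.div dD h3).congr_of_eventuallyEq ?_
    filter_upwards [h4] with z hz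
    by_cases hzc : z = c
    · subst hzc
      simp [hc, dslope_same]
    · have e1 : D z = (z - c) * dslope D c z := by
        have := sub_smul_dslope D c z
        rw [hc, sub_zero, smul_eq_mul] at this
        exact this.symm
      have e2 : N z = (z - c) * dslope N c z := by
        have := sub_smul_dslope N c z
        rw [h1, sub_zero, smul_eq_mul] at this
        exact this.symm
      have hz' : z - c ≠ 0 := sub_ne_zero.2 hzc
      have : D z ≠ 0 := by rw [e1]; exact mul_ne_zero hz' hz
      simp only [this, if_false, Pi.div_apply]
      rw [e1, e2, mul_div_mul_left _ _ hz']
  · refine ((hN c).div (hD c) hc).congr_of_eventuallyEq ?_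
    filter_upwards [(hD c).continuousAt.eventually_ne hc] with z hz
    simp [hz]

noncomputable def a : ℂ := Complex.exp (Complex.I * π / 4)
noncomputable def b : ℂ := Complex.exp (Complex.I * π / 3)

noncomputable def p0 : ℂ := (2 - 4 * a + 2 * b + 2 * a * b) / 6
noncomputable def p1 : ℂ := (-1 + a - b + a * b) / 6
noncomputable def p2 : ℂ := -(1 + a + b + a * b) / 6
noncomputable def p3 : ℂ := (2 + 4 * a + 2 * b - 2 * a * b) / 6

noncomputable def P (u : ℂ) : ℂ := p0 + p1 * (u + u ^ 5) + p2 * (u ^ 2 + u ^ 4) + p3 * u ^ 3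
noncomputable def q : ℝ := 2 * π / √3
noncomputable def u (z : ℂ) : ℂ := Complex.exp (q * z)
noncomputable def E (z : ℂ) : ℂ := Complex.exp (Complex.I * π * z ^ 2)
noncomputable def N (z : ℂ) : ℂ := E z * u z ^ 4 * (1 - u z) - P (u z)
noncomputable def D (z : ℂ) : ℂ := 1 - u z ^ 6
noncomputable def G (z : ℂ) : ℂ := if D z = 0 then deriv N z / deriv D z else N z / D z

lemma a_eq : a = √2 / 2 + √2 / 2 * Complex.I := by
  have : Complex.I * π / 4 = ((π / 4 : ℝ) : ℂ) * Complex.I := by push_cast; ring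
  rw [a, this, Complex.exp_mul_I, ← Complex.ofReal_cos, ← Complex.ofReal_sin,
    Real.cos_pi_div_four, Real.sin_pi_div_four]
  push_cast; ring

lemma b_eq : b = 1 / 2 + √3 / 2 * Complex.I := by
  have : Complex.I * π / 3 = ((π / 3 : ℝ) : ℂ) * Complex.I := by push_cast; ring
  rw [b, this, Complex.exp_mul_I, ← Complex.ofReal_cos, ← Complex.ofReal_sin,
    Real.cos_pi_div_three, Real.sin_pi_div_three]
  push_cast; ring

lemma s3 : ((√3 : ℝ) : ℂ) ^ 2 = 3 := by
  rw [← Complex.ofReal_pow, Real.sq_sqrt (by norm_num)]; norm_num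

lemma s3ne : ((√3 : ℝ) : ℂ) ≠ 0 := by
  intro h; have := s3; rw [h] at this; norm_num at this

lemma b_sq : b ^ 2 = b - 1 := by
  rw [b_eq]
  linear_combination (1 / 4) * Complex.I ^ 2 * s3 + 3 / 4 * Complex.I_sq

lemma hu : Differentiable ℂ u := by unfold u; fun_prop
lemma hE : Differentiable ℂ E := by unfold E; fun_prop
lemma hN : Differentiable ℂ N := by
  have := hu; have := hE; unfold N P; fun_prop
lemma hD : Differentiable ℂ D := by
  have := hu; unfold D; fun_prop

lemma q_pos : 0 < q := by unfold q; positivity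

lemma q_s : q * √3 = 2 * π := by unfold q; field_simp

lemma deriv_D (z : ℂ) : deriv D z = -(6 * u z ^ 6 * q) := by
  have h1 : HasDerivAt u (u z * q) z := by
    have := ((hasDerivAt_id z).const_mul (q : ℂ)).cexp
    simp only [id, mul_one] at this
    exact this
  have h2 : HasDerivAt D (-(6 * u z ^ 5 * (u z * q))) z := by
    have := (h1.pow 6).const_sub 1
    norm_num at this
    exact this
  rw [h2.deriv]; ring

lemma zeros (z : ℂ) (hz : D z = 0) : ∃ n : ℤ, z = Complex.I * √3 / 6 * n := by
  have h : Complex.exp (6 * (q * z)) = 1 := by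
    have : u z ^ 6 = 1 := by unfold D at hz; linear_combination -hz
    rw [← this, u, ← Complex.exp_nat_mul]; norm_num
  obtain ⟨n, hn⟩ := Complex.exp_eq_one_iff.1 h
  refine ⟨n, ?_⟩
  have hq : (q : ℂ) * √3 = 2 * π := by exact_mod_cast q_s
  have hpi : (2 * π : ℂ) ≠ 0 := by exact_mod_cast Real.two_pi_pos.ne'
  apply mul_left_cancel₀ hpi
  linear_combination (√3 / 6 : ℂ) * hn - z * hq

lemma u_at (n : ℕ) : u (Complex.I * √3 / 6 * n) = b ^ n := by
  have hq : (q : ℂ) * √3 = 2 * π := by exact_mod_cast q_s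
  rw [u, b, ← Complex.exp_nat_mul]
  congr 1
  linear_combination (Complex.I / 6 * n) * hq

lemma E_at (n : ℕ) : E (Complex.I * √3 / 6 * n) = Complex.exp (-(n ^ 2 * (Complex.I * π / 12))) := by
  rw [E]
  congr 1
  linear_combination (Complex.I * π / 36 * n ^ 2 * Complex.I ^ 2) * s3 +
    (Complex.I * π / 12 * n ^ 2) * Complex.I_sq

lemma e1 : Complex.exp (-(Complex.I * π / 12)) = - a * b ^ 2 := by
  have : -a * b ^ 2 = a * b ^ 2 * Complex.exp (π * Complex.I) := by
    rw [Complex.exp_pi_mul_I]; ring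
  rw [this, a, b, ← Complex.exp_nat_mul, ← Complex.exp_add, ← Complex.exp_add,
    Complex.exp_eq_exp_iff_exists_int]
  exact ⟨-1, by push_cast; ring⟩

lemma e4 : Complex.exp (-(4 * (Complex.I * π / 12))) = - b ^ 2 := by
  have : - b ^ 2 = b ^ 2 * Complex.exp (π * Complex.I) := by
    rw [Complex.exp_pi_mul_I]; ring
  rw [this, b, ← Complex.exp_nat_mul, ← Complex.exp_add,
    Complex.exp_eq_exp_iff_exists_int]
  exact ⟨-1, by push_cast; ring⟩

lemma e9 : Complex.exp (-(9 * (Complex.I * π / 12))) = - a := by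
  have : - a = a * Complex.exp (π * Complex.I) := by
    rw [Complex.exp_pi_mul_I]; ring
  rw [this, a, ← Complex.exp_add,
    Complex.exp_eq_exp_iff_exists_int]
  exact ⟨-1, by push_cast; ring⟩

lemma e16 : Complex.exp (-(16 * (Complex.I * π / 12))) = b ^ 2 := by
  rw [b, ← Complex.exp_nat_mul,
    Complex.exp_eq_exp_iff_exists_int]
  exact ⟨-1, by push_cast; ring⟩

lemma e25 : Complex.exp (-(25 * (Complex.I * π / 12))) = - a * b ^ 2 := by
  rw [← e1, Complex.exp_eq_exp_iff_exists_int]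
  exact ⟨-1, by push_cast; ring⟩

lemma b3 : b ^ 3 = -1 := by linear_combination (b + 1) * b_sq

lemma N_zero (z : ℂ) (h0 : 0 ≤ z.im) (h1 : z.im ≤ √3) (hz : D z = 0) : N z = 0 := by
  obtain ⟨n, rfl⟩ := zeros z hz
  have hs : (0:ℝ) < √3 := by positivity
  have him : (Complex.I * √3 / 6 * n : ℂ).im = √3 / 6 * n := by
    have : (Complex.I * √3 / 6 * n : ℂ) = ((√3 / 6 * n : ℝ) : ℂ) * Complex.I := by
      push_cast; ring
    rw [this, Complex.im_ofReal_mul, Complex.I_im, mul_one]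
  rw [him] at h0 h1
  have hn0 : 0 ≤ n := by
    have : (0:ℝ) ≤ n := by
      by_contra! h
      nlinarith
    exact_mod_cast this
  lift n to ℕ using hn0
  have hn6 : n ≤ 6 := by
    have : (n:ℝ) ≤ 6 := by
      by_contra! h
      push_cast at h1
      nlinarith
    exact_mod_cast this
  rw [Int.cast_natCast, N, u_at, E_at]
  have hb := b_sq
  have h3 := b3
  have h4 : b ^ 4 = -b := by linear_combination b * b3
  have h5 : b ^ 5 = -b^2 := by linear_combination b^2 * b3
  have h6 : b ^ 6 = 1 := by linear_combination (b^3 - 1) * b3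
  unfold P p0 p1 p2 p3
  interval_cases n
  · simp; ring
  · norm_num [e1]
    grind
  · norm_num [e4]
    grind
  · norm_num [e9]
    grind
  · norm_num [e16]
    grind
  · norm_num [e25]
    grind
  · rw [h6]; ring

lemma hG (z : ℂ) (h0 : 0 ≤ z.im) (h1 : z.im ≤ √3) : DifferentiableAt ℂ G z := by
  refine diffAt_quot N D hN hD z fun h => ⟨N_zero z h0 h1 h, ?_⟩
  rw [deriv_D, neg_ne_zero]
  have : (q : ℂ) ≠ 0 := by exact_mod_cast q_pos.ne'
  simp [this, u]

lemma rect (T : ℝ) :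
    (∫ x : ℝ in (-T)..T, G x) - (∫ x : ℝ in (-T)..T, G (x + √3 * Complex.I)) +
      Complex.I * (∫ y : ℝ in (0:ℝ)..√3, G (T + y * Complex.I)) -
      Complex.I * (∫ y : ℝ in (0:ℝ)..√3, G (-T + y * Complex.I)) = 0 := by
  have := Complex.integral_boundary_rect_eq_zero_of_differentiableOn G (-T : ℂ)
    (T + √3 * Complex.I) ?_
  · simpa using this
  · intro z hz
    rw [Complex.mem_reProdIm] at hz
    have h2 := hz.2
    simp only [Complex.neg_im, Complex.ofReal_im, neg_zero, Complex.add_im, Complex.mul_im,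
      Complex.ofReal_re, Complex.I_im, mul_one, Complex.I_re, mul_zero, add_zero, zero_add,
      Set.uIcc_of_le (Real.sqrt_nonneg 3)] at h2
    exact (hG z h2.1 h2.2).differentiableWithinAt

noncomputable def K : ℝ := ‖p0‖ + ‖p1‖ + ‖p2‖ + ‖p3‖

lemma bound_right (e w : ℂ) (he : ‖e‖ ≤ 1) (hw : 2 ≤ ‖w‖) :
    ‖(e * w ^ 4 * (1 - w) - P w) / (1 - w ^ 6)‖ ≤ (4 + 4 * K) * ‖w‖⁻¹ := by
  set U := ‖w‖ with hU
  have hD : U ^ 6 / 2 ≤ ‖1 - w ^ 6‖ := by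
    have := norm_sub_norm_le (w ^ 6) 1
    rw [norm_sub_rev, norm_pow, norm_one, ← hU] at this
    have h2 : (2:ℝ) ^ 6 ≤ U ^ 6 := by gcongr
    linarith
  have hp : ∀ i ≤ 5, U ^ i ≤ U ^ 5 := fun i hi => pow_le_pow_right₀ (by linarith) hi
  have h1 : ‖e * w ^ 4 * (1 - w)‖ ≤ 2 * U ^ 5 := by
    rw [norm_mul, norm_mul, norm_pow, ← hU]
    have : ‖1 - w‖ ≤ 1 + U := by simpa using norm_sub_le 1 w
    calc ‖e‖ * U ^ 4 * ‖1 - w‖ ≤ 1 * U ^ 4 * (1 + U) := by gcongr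
      _ ≤ 2 * U ^ 5 := by have := hp 4 (by norm_num); nlinarith
  have h2 : ‖P w‖ ≤ 2 * K * U ^ 5 := by
    unfold P K
    have t0 : ‖p0‖ ≤ ‖p0‖ * U ^ 5 := by
      have := hp 0 (by norm_num); simp only [pow_zero] at this
      exact le_mul_of_one_le_right (norm_nonneg _) this
    have t1 : ‖p1 * (w + w ^ 5)‖ ≤ ‖p1‖ * (2 * U ^ 5) := by
      rw [norm_mul]; gcongr
      refine (norm_add_le _ _).trans ?_
      rw [norm_pow, ← hU]
      have := hp 1 (by norm_num); rw [pow_one] at this; linarith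
    have t2 : ‖p2 * (w ^ 2 + w ^ 4)‖ ≤ ‖p2‖ * (2 * U ^ 5) := by
      rw [norm_mul]; gcongr
      refine (norm_add_le _ _).trans ?_
      rw [norm_pow, norm_pow, ← hU]
      have := hp 2 (by norm_num); have := hp 4 (by norm_num); linarith
    have t3 : ‖p3 * w ^ 3‖ ≤ ‖p3‖ * U ^ 5 := by
      rw [norm_mul, norm_pow, ← hU]; gcongr 1; exact hp 3 (by norm_num)
    have := norm_add₄_le (a := p0) (b := p1 * (w + w ^ 5)) (c := p2 * (w ^ 2 + w ^ 4))
      (d := p3 * w ^ 3)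
    have n0 : 0 ≤ ‖p0‖ * U ^ 5 := by positivity
    have n3 : 0 ≤ ‖p3‖ * U ^ 5 := by positivity
    linarith
  have hU0 : 0 < U := by linarith
  rw [norm_div, div_le_iff₀ (by nlinarith [pow_pos hU0 6])]
  have hK : 0 ≤ K := by unfold K; positivity
  calc _ ≤ 2 * U ^ 5 + 2 * K * U ^ 5 := (norm_sub_le _ _).trans (add_le_add h1 h2)
    _ = (4 + 4 * K) * U⁻¹ * (U ^ 6 / 2) := by field_simp; ring
    _ ≤ _ := by gcongr

lemma bound_left (e w : ℂ) (he : ‖e‖ * ‖w‖ ^ 3 ≤ 1) (hw : ‖w‖ ≤ 1 / 2) :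
    ‖(e * w ^ 4 * (1 - w) - P w) / (1 - w ^ 6) + p0‖ ≤ (4 + 4 * K) * ‖w‖ := by
  set U := ‖w‖ with hU
  have hU0 : 0 ≤ U := norm_nonneg _
  have hD : 1 / 2 ≤ ‖1 - w ^ 6‖ := by
    have := norm_sub_norm_le 1 (w ^ 6)
    rw [norm_pow, norm_one, ← hU] at this
    have h2 : U ^ 6 ≤ (1/2:ℝ) ^ 6 := by gcongr
    norm_num at h2
    linarith
  have hD0 : 1 - w ^ 6 ≠ 0 := by
    intro h; rw [h] at hD; norm_num at hD
  have hp : ∀ i, 1 ≤ i → U ^ i ≤ U := fun i hi => by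
    simpa using pow_le_pow_of_le_one hU0 (by linarith) hi
  have h1 : ‖e * w ^ 4 * (1 - w)‖ ≤ 2 * U := by
    rw [norm_mul, norm_mul, norm_pow, ← hU]
    have : ‖1 - w‖ ≤ 1 + U := by simpa using norm_sub_le 1 w
    calc ‖e‖ * U ^ 4 * ‖1 - w‖ = (‖e‖ * U ^ 3) * U * ‖1 - w‖ := by ring
      _ ≤ 1 * U * (1 + 1) := by gcongr; linarith
      _ = 2 * U := by ring
  have t0 : ‖p0 * w ^ 6‖ ≤ ‖p0‖ * U := by
    rw [norm_mul, norm_pow, ← hU]; gcongr 1; exact hp 6 (by norm_num)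
  have t1 : ‖p1 * (w + w ^ 5)‖ ≤ ‖p1‖ * (2 * U) := by
    rw [norm_mul]; gcongr
    refine (norm_add_le _ _).trans ?_
    rw [norm_pow, ← hU]
    have := hp 5 (by norm_num); linarith
  have t2 : ‖p2 * (w ^ 2 + w ^ 4)‖ ≤ ‖p2‖ * (2 * U) := by
    rw [norm_mul]; gcongr
    refine (norm_add_le _ _).trans ?_
    rw [norm_pow, norm_pow, ← hU]
    have := hp 2 (by norm_num); have := hp 4 (by norm_num); linarith
  have t3 : ‖p3 * w ^ 3‖ ≤ ‖p3‖ * U := by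
    rw [norm_mul, norm_pow, ← hU]; gcongr 1; exact hp 3 (by norm_num)
  have h2 : ‖p0 * w ^ 6 + p1 * (w + w ^ 5) + p2 * (w ^ 2 + w ^ 4) + p3 * w ^ 3‖ ≤ 2 * K * U := by
    unfold K
    have := norm_add₄_le (a := p0 * w ^ 6) (b := p1 * (w + w ^ 5)) (c := p2 * (w ^ 2 + w ^ 4))
      (d := p3 * w ^ 3)
    have n0 : 0 ≤ ‖p0‖ * U := by positivity
    have n3 : 0 ≤ ‖p3‖ * U := by positivity
    linarith
  have hK : 0 ≤ K := by unfold K; positivity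
  have e : (e * w ^ 4 * (1 - w) - P w) / (1 - w ^ 6) + p0 =
      (e * w ^ 4 * (1 - w) - (p0 * w ^ 6 + p1 * (w + w ^ 5) + p2 * (w ^ 2 + w ^ 4) + p3 * w ^ 3))
        / (1 - w ^ 6) := by
    rw [div_add' _ _ _ hD0]; unfold P; congr 1; ring
  rw [e, norm_div, div_le_iff₀ (by linarith)]
  calc _ ≤ 2 * U + 2 * K * U := (norm_sub_le _ _).trans (add_le_add h1 h2)
    _ = (4 + 4 * K) * U * (1 / 2) := by ring
    _ ≤ _ := by gcongr

lemma norm_u (x y : ℝ) : ‖u (x + y * Complex.I)‖ = Real.exp (q * x) := by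
  rw [u, Complex.norm_exp]; simp

lemma norm_E (x y : ℝ) : ‖E (x + y * Complex.I)‖ = Real.exp (-(2 * π * x * y)) := by
  rw [E, Complex.norm_exp]
  congr 1
  have : Complex.I * π * ((x:ℂ) + y * Complex.I) ^ 2 =
      ((-(2 * π * x * y) : ℝ) : ℂ) + ((π * (x ^ 2 - y ^ 2) : ℝ) : ℂ) * Complex.I := by
    push_cast
    linear_combination (π * x * y * 2 + Complex.I * π * y ^ 2) * Complex.I_sq
  rw [this, Complex.add_re, Complex.re_ofReal_mul, Complex.I_re, Complex.ofReal_re]; ring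

lemma G_eq (z : ℂ) (h : D z ≠ 0) :
    G z = (E z * u z ^ 4 * (1 - u z) - P (u z)) / (1 - u z ^ 6) := by
  rw [G, if_neg h]; rfl

lemma D_ne (x y : ℝ) (hx : x ≠ 0) : D (x + y * Complex.I) ≠ 0 := by
  intro h
  have h1 : u (x + y * Complex.I) ^ 6 = 1 := by unfold D at h; linear_combination -h
  have h2 : ‖u (x + y * Complex.I)‖ ^ 6 = 1 := by rw [← norm_pow, h1, norm_one]
  rw [norm_u, pow_eq_one_iff_of_nonneg (Real.exp_pos _).le (by norm_num), Real.exp_eq_one_iff] at h2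
  exact (mul_ne_zero q_pos.ne' hx) h2

lemma G_right (T y : ℝ) (hT : 2 ≤ Real.exp (q * T)) (hT0 : 0 < T) (hy : 0 ≤ y) :
    ‖G (T + y * Complex.I)‖ ≤ (4 + 4 * K) * Real.exp (-(q * T)) := by
  rw [G_eq _ (D_ne T y hT0.ne'), Real.exp_neg, ← norm_u T y]
  apply bound_right
  · rw [norm_E, Real.exp_le_one_iff]
    have : 0 ≤ 2 * π * T * y := by positivity
    linarith
  · rwa [norm_u]

lemma G_left (T y : ℝ) (hT : 2 ≤ Real.exp (q * T)) (hT0 : 0 < T) (hy : y ≤ √3) :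
    ‖G (-T + y * Complex.I) + p0‖ ≤ (4 + 4 * K) * Real.exp (-(q * T)) := by
  have hc : (-T + y * Complex.I : ℂ) = ((-T : ℝ) : ℂ) + y * Complex.I := by push_cast; rfl
  rw [hc, G_eq _ (D_ne (-T) y (by linarith)), ← mul_neg, ← norm_u (-T) y]
  apply bound_left
  · rw [norm_E, norm_u, ← Real.exp_nat_mul, ← Real.exp_add, Real.exp_le_one_iff]
    have h3 : q * 3 = 2 * π * √3 := by
      rw [← q_s, mul_assoc, Real.mul_self_sqrt (by norm_num)]
    have : 2 * π * T * y ≤ 2 * π * T * √3 := by gcongr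
    push_cast
    nlinarith
  · rw [norm_u, mul_neg, Real.exp_neg, one_div]
    exact inv_anti₀ (by norm_num) hT

noncomputable def g (x : ℝ) : ℂ := E x / (1 + 2 * Real.cosh (q * x))

lemma G_diff (x : ℝ) (hx : x ≠ 0) : G x - G (x + √3 * Complex.I) = g x := by
  have d0 : D x ≠ 0 := by simpa using D_ne x 0 hx
  have hq : (q : ℂ) * √3 = 2 * π := by exact_mod_cast q_s
  rw [G_eq _ d0, G_eq _ (D_ne x √3 hx)]
  have hu' : u (x + √3 * Complex.I) = u x := by
    rw [u, u, Complex.exp_eq_exp_iff_exists_int]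
    exact ⟨1, by push_cast; linear_combination Complex.I * hq⟩
  have hE' : E (x + √3 * Complex.I) * u x ^ 3 = - E x := by
    have : - E x = E x * Complex.exp (π * Complex.I) := by
      rw [Complex.exp_pi_mul_I]; ring
    rw [this, E, E, u, ← Complex.exp_nat_mul, ← Complex.exp_add, ← Complex.exp_add,
      Complex.exp_eq_exp_iff_exists_int]
    refine ⟨-2, ?_⟩
    have h3 : (q : ℂ) * 3 = 2 * π * √3 := by rw [← hq, ← s3]; ring
    push_cast
    linear_combination (x : ℂ) * h3 + Complex.I ^ 3 * π * s3 +
      (2 * π * x * √3 + 3 * Complex.I * π) * Complex.I_sq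
  rw [hu']
  have hu0 : u x ≠ 0 := Complex.exp_ne_zero _
  have hc : 2 * (Real.cosh (q * x) : ℂ) = u x + (u x)⁻¹ := by
    rw [Complex.ofReal_cosh, Complex.two_cosh, u, ← Complex.exp_neg]; push_cast; rfl
  have hden : 1 + 2 * (Real.cosh (q * x) : ℂ) ≠ 0 := by
    have : 0 < 1 + 2 * Real.cosh (q * x) := by have := Real.cosh_pos (q * x); linarith
    exact_mod_cast this.ne'
  unfold D at d0
  have hnum : (E x * u x ^ 4 * (1 - u x) - P (u x)) -
      (E (x + √3 * Complex.I) * u x ^ 4 * (1 - u x) - P (u x)) =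
      E x * u x * (1 - u x) * (1 + u x ^ 3) := by
    linear_combination -(u x * (1 - u x)) * hE'
  rw [← sub_div, hnum, g, div_eq_div_iff d0 hden, hc]
  field_simp
  ring

lemma ccont (f : ℝ → ℂ) (hf : Continuous f) (c d : ℝ) 
    (h : ∀ x ∈ Set.uIcc c d, 0 ≤ (f x).im ∧ (f x).im ≤ √3) :
    IntervalIntegrable (fun x => G (f x)) volume c d := by
  apply ContinuousOn.intervalIntegrable
  intro x hx
  exact ((hG _ (h x hx).1 (h x hx).2).continuousAt.comp hf.continuousAt).continuousWithinAt

lemma identity (T : ℝ) :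
    (∫ x : ℝ in (-T)..T, g x) + Complex.I * √3 * p0 =
      Complex.I * (∫ y : ℝ in (0:ℝ)..√3, (G (-T + y * Complex.I) + p0))
      - Complex.I * (∫ y : ℝ in (0:ℝ)..√3, G (T + y * Complex.I)) := by
  have hr := rect T
  have h1 : (∫ x : ℝ in (-T)..T, g x) =
      (∫ x : ℝ in (-T)..T, G x) - (∫ x : ℝ in (-T)..T, G (x + √3 * Complex.I)) := by
    rw [← intervalIntegral.integral_sub]
    · apply intervalIntegral.integral_congr_ae
      have : ∀ᵐ x : ℝ, x ≠ 0 := by simp [ae_iff]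
      filter_upwards [this] with x hx _
      exact (G_diff x hx).symm
    · exact ccont (fun x => x) (by fun_prop) _ _ (by simp)
    · exact ccont (fun x => x + √3 * Complex.I) (by fun_prop) _ _ (by simp)
  have h2 : (∫ y : ℝ in (0:ℝ)..√3, (G (-T + y * Complex.I) + p0)) =
      (∫ y : ℝ in (0:ℝ)..√3, G (-T + y * Complex.I)) + √3 * p0 := by
    rw [intervalIntegral.integral_add]
    · simp
    · refine ccont (fun y => -T + y * Complex.I) (by fun_prop) _ _ ?_
      intro x hx
      rw [Set.uIcc_of_le (Real.sqrt_nonneg 3)] at hx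
      simpa using hx
    · simp
  rw [h1, h2]
  linear_combination hr

lemma lim : Tendsto (fun T : ℝ => ∫ x : ℝ in (-T)..T, g x) atTop (𝓝 (-(Complex.I * √3 * p0))) := by
  have hexp : Tendsto (fun T : ℝ => Real.exp (q * T)) atTop atTop :=
    Real.tendsto_exp_atTop.comp (tendsto_id.const_mul_atTop q_pos)
  have hb : Tendsto (fun T : ℝ => 2 * ((4 + 4 * K) * Real.exp (-(q * T)) * √3)) atTop (𝓝 0) := by
    have : Tendsto (fun T : ℝ => Real.exp (-(q * T))) atTop (𝓝 0) := by
      simp_rw [Real.exp_neg]; exact hexp.inv_tendsto_atTop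
    have := ((this.const_mul (4 + 4 * K)).mul_const (√3)).const_mul 2
    simpa using this
  rw [tendsto_iff_norm_sub_tendsto_zero]
  refine squeeze_zero' (Eventually.of_forall fun _ => norm_nonneg _) ?_ hb
  filter_upwards [hexp.eventually_ge_atTop 2, eventually_gt_atTop 0] with T h2 h0
  rw [sub_neg_eq_add, identity T]
  refine (norm_sub_le _ _).trans ?_
  rw [norm_mul, norm_mul, Complex.norm_I, one_mul, one_mul, two_mul]
  have hs : |√3 - 0| = √3 := by simp
  refine add_le_add ?_ ?_
  · refine (intervalIntegral.norm_integral_le_of_norm_le_const (C := (4 + 4 * K) * Real.exp (-(q * T))) ?_).trans_eq (by rw [hs])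
    intro y hy
    rw [Set.uIoc_of_le (Real.sqrt_nonneg 3)] at hy
    exact G_left T y h2 h0 hy.2
  · refine (intervalIntegral.norm_integral_le_of_norm_le_const (C := (4 + 4 * K) * Real.exp (-(q * T))) ?_).trans_eq (by rw [hs])
    intro y hy
    rw [Set.uIoc_of_le (Real.sqrt_nonneg 3)] at hy
    exact G_right T y h2 h0 hy.1.le

noncomputable def f (x : ℝ) : ℝ :=
  Real.sin (π * x ^ 2) / (1 + 2 * Real.cosh (2 * π * x / Real.sqrt 3))

lemma g_im (x : ℝ) : (g x).im = f x := by
  have h1 : E x = Real.cos (π * x ^ 2) + Real.sin (π * x ^ 2) * Complex.I := by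
    rw [E, Complex.ofReal_cos, Complex.ofReal_sin, ← Complex.exp_mul_I]
    congr 1; push_cast; ring
  have h2 : (1 + 2 * Real.cosh (q * x) : ℂ) = ((1 + 2 * Real.cosh (q * x) : ℝ) : ℂ) := by
    push_cast; rfl
  have h3 : q * x = 2 * π * x / √3 := by unfold q; ring
  rw [g, h1, h2, Complex.div_ofReal_im, f, h3, Complex.add_im, Complex.im_ofReal_mul, Complex.I_im,
    Complex.ofReal_im]
  simp only [zero_add, mul_one]

lemma cosh_pos' (x : ℝ) : 0 < 1 + 2 * Real.cosh x := by
  have := Real.cosh_pos x; linarith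

lemma f_cont : Continuous f := by
  unfold f
  refine Continuous.div (by fun_prop) (by fun_prop) fun x => (cosh_pos' _).ne'

lemma g_cont : Continuous g := by
  unfold g
  refine Continuous.div (hE.continuous.comp (by fun_prop)) (by fun_prop) fun x => ?_
  exact_mod_cast (cosh_pos' (q * x)).ne'

lemma f_int : IntegrableOn f (Set.Ioi 0) := by
  refine Integrable.mono' (g := fun x => Real.exp (-q * x))
    (exp_neg_integrableOn_Ioi 0 q_pos) f_cont.aestronglyMeasurable ?_
  refine Eventually.of_forall fun x => ?_
  have h3 : 2 * π * x / √3 = q * x := by unfold q; ring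
  rw [f, h3, Real.norm_eq_abs, abs_div, abs_of_pos (cosh_pos' _), div_le_iff₀ (cosh_pos' _)]
  refine (Real.abs_sin_le_one _).trans ?_
  have : 1 = Real.exp (-q * x) * Real.exp (q * x) := by rw [← Real.exp_add]; simp
  nth_rewrite 1 [this]
  gcongr
  rw [Real.cosh_eq]
  have := Real.exp_pos (-(q * x))
  linarith

lemma im_int (T : ℝ) : (∫ x : ℝ in (-T)..T, g x).im = 2 * ∫ x in (0:ℝ)..T, f x := by
  have h1 : (∫ x : ℝ in (-T)..T, g x).im = ∫ x : ℝ in (-T)..T, f x := by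
    have := Complex.imCLM.intervalIntegral_comp_comm (g_cont.intervalIntegrable (μ := volume) (-T) T)
    simp only [Complex.imCLM_apply, g_im] at this
    exact this.symm
  rw [h1, ← intervalIntegral.integral_add_adjacent_intervals (b := 0)
    (f_cont.intervalIntegrable _ _) (f_cont.intervalIntegrable _ _)]
  have h2 : ∫ x in (-T)..0, f x = ∫ x in (0:ℝ)..T, f x := by
    have := intervalIntegral.integral_comp_neg (a := 0) (b := T) f
    rw [neg_zero] at this
    rw [← this]
    congr 1; ext x; unfold f
    have : 2 * π * (-x) / √3 = -(2 * π * x / √3) := by ring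
    rw [this, Real.cosh_neg, neg_sq]
  rw [h2]; ring

lemma final_val : (-(Complex.I * √3 * p0)).im = 2 * ((-√12 + √2 + √6) / 8) := by
  have h12 : √12 = 2 * √3 := by
    rw [show (12:ℝ) = 2 ^ 2 * 3 by norm_num, Real.sqrt_mul (by norm_num), Real.sqrt_sq (by norm_num)]
  have h6 : √6 = √2 * √3 := by
    rw [← Real.sqrt_mul (by norm_num)]; norm_num
  have h3 : √3 * √3 = 3 := Real.mul_self_sqrt (by norm_num)
  have : -(Complex.I * √3 * p0) =
      ((√3 * ((-2 * √2 + √3 + √2 / 2 * (1 + √3)) / 6) : ℝ) : ℂ) +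
      ((-√3 * ((3 - 3 * √2 / 2 - √2 * √3 / 2) / 6) : ℝ) : ℂ) * Complex.I := by
    rw [p0, a_eq, b_eq]
    push_cast
    ring_nf
    simp only [Complex.I_sq, Complex.I_pow_three]
    ring
  rw [this, Complex.add_im, Complex.im_ofReal_mul, Complex.I_im, Complex.ofReal_im, h12, h6]
  linear_combination (√2 / 12) * h3

end Mordell

theorem stmt10 :
    ∫ x in Set.Ioi (0:ℝ), Real.sin (π * x ^ 2) / (1 + 2 * Real.cosh (2 * π * x / Real.sqrt 3)) = (-Real.sqrt 12 + Real.sqrt 2 + Real.sqrt 6) / 8 := by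
  have h1 := (Complex.continuous_im.tendsto _).comp Mordell.lim
  have h2 := (intervalIntegral_tendsto_integral_Ioi 0 Mordell.f_int Filter.tendsto_id).const_mul 2
  have h3 := tendsto_nhds_unique (h1.congr fun T => Mordell.im_int T) h2
  rw [Mordell.final_val] at h3
  have h4 := mul_left_cancel₀ two_ne_zero h3
  exact h4.symm
end
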